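/- arXiv:1502.01616 — 2 statements merged into one kernel-verified Lean document; each statement's English description precedes it below -/
import Mathlib

section
/- (Von Neumann's trace inequality for real matrices.) For all real matrices A, B ∈ ℝ^{m×n} with m ≤ n, trace(Aᵀ · B) ≤ ∑_{k=1}^{m} σ_k(A) · σ_k(B). -/
open scoped BigOperators Matrix

/-- The entries of `v` sorted in nonincreasing order. -/
noncomputable def sortDesc {m : ℕ} (v : Fin m → ℝ) : Fin m → ℝ :=
  fun k => (v ∘ Tuple.sort v) k.rev

theorem gram_isHermitian {m : ℕ} {J : Type*} [Fintype J]
    (A : Matrix (Fin m) J ℝ) : (A * Aᵀ).IsHermitian := by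
  ext i j
  simp [Matrix.conjTranspose_apply, Matrix.mul_apply, Matrix.transpose_apply, mul_comm]

/-- Singular values of a real matrix `A`: the square roots of the eigenvalues of
the positive semidefinite matrix `A * Aᵀ`, in nonincreasing order. -/
noncomputable def singularValues {m : ℕ} {J : Type*} [Fintype J]
    (A : Matrix (Fin m) J ℝ) : Fin m → ℝ :=
  fun k => Real.sqrt (sortDesc (gram_isHermitian A).eigenvalues k)

variable {D : ℕ} {n : Fin D → ℕ}

/-- Inner product of two tensors. -/
noncomputable def tinner (X Y : (∀ d, Fin (n d)) → ℝ) : ℝ :=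
  ∑ i : ∀ d, Fin (n d), X i * Y i

/-- Mode-`d` matricization of the tensor `X`. -/
def matricize (X : (∀ d, Fin (n d)) → ℝ) (d : Fin D) :
    Matrix (Fin (n d)) (∀ d' : {d' : Fin D // d' ≠ d}, Fin (n d')) ℝ :=
  Matrix.of fun k j =>
    X (fun d' => if h : d' = d then Fin.cast (congrArg n h.symm) k else j ⟨d', h⟩)

/-- Mode-`d` singular values of a tensor. -/
noncomputable def modeSV (X : (∀ d, Fin (n d)) → ℝ) (d : Fin D) : Fin (n d) → ℝ :=
  singularValues (matricize X d)

/-- The multilinear (Tucker) product `X ×₁ U 1 ×₂ ⋯ ×_D U D`. -/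
noncomputable def tuckerMul (X : (∀ d, Fin (n d)) → ℝ)
    (U : ∀ d, Matrix (Fin (n d)) (Fin (n d)) ℝ) : (∀ d, Fin (n d)) → ℝ :=
  fun i => ∑ j : ∀ d, Fin (n d), (∏ d, U d (i d) (j d)) * X j

/-- Rectangular "diagonal" matrix with columns indexed by an arbitrary fintype,
identified with an initial segment of `ℕ` via `Fintype.equivFin`. -/
noncomputable def rectDiagJ {m : ℕ} {J : Type*} [Fintype J]
    (v : Fin m → ℝ) : Matrix (Fin m) J ℝ :=
  Matrix.of fun k j => if ((Fintype.equivFin J) j : ℕ) = (k : ℕ) then v k else 0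

theorem singularValues_nonneg {m : ℕ} {J : Type*} [Fintype J] (A : Matrix (Fin m) J ℝ)
    (k : Fin m) : 0 ≤ singularValues A k :=
  Real.sqrt_nonneg _

theorem singularValues_antitone {m : ℕ} {J : Type*} [Fintype J] (A : Matrix (Fin m) J ℝ) :
    Antitone (singularValues A) := fun _ _ h =>
  Real.sqrt_le_sqrt (Tuple.monotone_sort _ (Fin.rev_le_rev.mpr h))

/-- Bessel's inequality for the columns of a matrix that are pairwise orthogonal, of norm at
most one. -/
theorem sum_sq_transpose_mulVec_le {I J : Type*} [Fintype I] [DecidableEq I] [Fintype J]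
    (V : Matrix J I ℝ) (e : I → ℝ) (he : ∀ i, e i ≤ 1) (hV : Vᵀ * V = Matrix.diagonal e)
    (x : J → ℝ) : ∑ i, (Vᵀ *ᵥ x) i ^ 2 ≤ x ⬝ᵥ x := by
  set c := Vᵀ *ᵥ x with hc
  have h1 : x ⬝ᵥ (V *ᵥ c) = ∑ i, c i ^ 2 := by
    rw [Matrix.dotProduct_mulVec, ← Matrix.mulVec_transpose, ← hc]
    simp [dotProduct, sq]
  have h2 : (V *ᵥ c) ⬝ᵥ (V *ᵥ c) = ∑ i, e i * c i ^ 2 := by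
    rw [Matrix.dotProduct_mulVec, ← Matrix.mulVec_transpose, Matrix.mulVec_mulVec, hV]
    simp [dotProduct, Matrix.mulVec_diagonal, sq, mul_assoc]
  have h3 : ∑ i, e i * c i ^ 2 ≤ ∑ i, c i ^ 2 :=
    Finset.sum_le_sum fun i _ => mul_le_of_le_one_left (sq_nonneg _) (he i)
  have h4 : 0 ≤ (x - V *ᵥ c) ⬝ᵥ (x - V *ᵥ c) :=
    Finset.sum_nonneg fun i _ => mul_self_nonneg _
  rw [sub_dotProduct, dotProduct_sub, dotProduct_sub, dotProduct_comm (V *ᵥ c) x, h1, h2] at h4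
  linarith

/-- A matrix with pairwise orthogonal rows factors as the diagonal matrix of the row norms times
a matrix whose nonzero rows are orthonormal. -/
theorem exists_eq_diagonal_sqrt_mul_transpose {I J : Type*} [Fintype I] [DecidableEq I]
    [Fintype J] (M : Matrix I J ℝ) (μ : I → ℝ) (hM : M * Mᵀ = Matrix.diagonal μ) :
    ∃ (V : Matrix J I ℝ) (e : I → ℝ), (∀ i, e i ≤ 1) ∧ Vᵀ * V = Matrix.diagonal e ∧
      M = Matrix.diagonal (fun i => Real.sqrt (μ i)) * Vᵀ := by
  have hμ : ∀ i, μ i = ∑ j, M i j ^ 2 := fun i => by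
    have := congrFun (congrFun hM i) i
    simp only [Matrix.mul_apply, Matrix.transpose_apply, Matrix.diagonal_apply_eq] at this
    simp [← this, sq]
  have hμ0 : ∀ i, 0 ≤ μ i := fun i => hμ i ▸ Finset.sum_nonneg fun j _ => sq_nonneg _
  refine ⟨Mᵀ * Matrix.diagonal (fun i => (Real.sqrt (μ i))⁻¹),
    fun i => (Real.sqrt (μ i))⁻¹ * μ i * (Real.sqrt (μ i))⁻¹, fun i => ?_, ?_, ?_⟩
  · change (Real.sqrt (μ i))⁻¹ * μ i * (Real.sqrt (μ i))⁻¹ ≤ 1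
    nth_rewrite 2 [← Real.mul_self_sqrt (hμ0 i)]
    rcases eq_or_ne (Real.sqrt (μ i)) 0 with h | h
    · simp [h]
    · exact le_of_eq (by field_simp)
  · rw [Matrix.transpose_mul, Matrix.transpose_transpose, Matrix.diagonal_transpose,
      Matrix.mul_assoc, ← Matrix.mul_assoc M, hM]
    simp [mul_assoc]
  · ext i j
    rw [Matrix.transpose_mul, Matrix.transpose_transpose, Matrix.diagonal_transpose,
      Matrix.diagonal_mul, Matrix.diagonal_mul]
    rcases eq_or_ne (Real.sqrt (μ i)) 0 with h | h
    · rw [Real.sqrt_eq_zero (hμ0 i), hμ i,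
        Finset.sum_eq_zero_iff_of_nonneg fun j _ => sq_nonneg _] at h
      simp [pow_eq_zero_iff two_ne_zero |>.mp (h j (Finset.mem_univ j))]
    · rw [mul_inv_cancel_left₀ h]

/-- Singular value decomposition; the columns of `V` belonging to zero singular values vanish. -/
theorem exists_eq_mul_diagonal_singularValues_mul_transpose {m : ℕ} {J : Type*} [Fintype J]
    (A : Matrix (Fin m) J ℝ) :
    ∃ (U : Matrix (Fin m) (Fin m) ℝ) (V : Matrix J (Fin m) ℝ) (e : Fin m → ℝ),
      Uᵀ * U = 1 ∧ (∀ i, e i ≤ 1) ∧ Vᵀ * V = Matrix.diagonal e ∧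
      A = U * Matrix.diagonal (singularValues A) * Vᵀ := by
  have hA := gram_isHermitian A
  let σ : Equiv.Perm (Fin m) := Fin.revPerm.trans (Tuple.sort hA.eigenvalues)
  let U₀ : Matrix (Fin m) (Fin m) ℝ := hA.eigenvectorUnitary
  have hU₀ : U₀ᵀ * U₀ = 1 := Unitary.coe_star_mul_self hA.eigenvectorUnitary
  have hgram : A * Aᵀ = U₀ * Matrix.diagonal hA.eigenvalues * U₀ᵀ := hA.spectral_theorem
  have hdiag : U₀ᵀ * (A * Aᵀ) * U₀ = Matrix.diagonal hA.eigenvalues := by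
    refine (congrArg (U₀ᵀ * · * U₀) hgram).trans ?_
    simp only [Matrix.mul_assoc]
    rw [hU₀, Matrix.mul_one, ← Matrix.mul_assoc, hU₀, Matrix.one_mul]
  let U := U₀.submatrix id σ
  have hU : Uᵀ * U = 1 := by
    rw [← Matrix.submatrix_one_equiv σ, ← hU₀]
    rfl
  have hM : (Uᵀ * A) * (Uᵀ * A)ᵀ = Matrix.diagonal (hA.eigenvalues ∘ σ) := by
    rw [← Matrix.submatrix_diagonal_equiv, ← hdiag, Matrix.transpose_mul,
      Matrix.transpose_transpose]
    ext i j
    simp only [← Matrix.mul_assoc]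
    rfl
  obtain ⟨V, e, he, hV, h⟩ := exists_eq_diagonal_sqrt_mul_transpose _ _ hM
  refine ⟨U, V, e, hU, he, hV, ?_⟩
  have h' : Uᵀ * A = Matrix.diagonal (singularValues A) * Vᵀ := h
  rw [Matrix.mul_assoc, ← h', ← Matrix.mul_assoc, mul_eq_one_comm.mp hU, Matrix.one_mul]

/-- Abel summation: pairing an antitone nonnegative sequence with a sequence whose partial sums
are nonnegative. -/
theorem Fin.sum_mul_nonneg_of_antitone {m : ℕ} (a d : Fin m → ℝ) (ha : Antitone a)
    (ha0 : ∀ i, 0 ≤ a i) (hd : ∀ k, 0 ≤ ∑ i ∈ Finset.Iic k, d i) : 0 ≤ ∑ i, a i * d i := by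
  have key : ∀ (k : ℕ) (hk : k < m),
      a ⟨k, hk⟩ * ∑ i ∈ Finset.Iic (⟨k, hk⟩ : Fin m), d i ≤
        ∑ i ∈ Finset.Iic (⟨k, hk⟩ : Fin m), a i * d i := by
    intro k
    induction k with
    | zero =>
      intro hk
      have : Finset.Iic (⟨0, hk⟩ : Fin m) = {⟨0, hk⟩} := by
        ext i; simp [Fin.le_def, Fin.ext_iff]
      simp [this]
    | succ k ih =>
      intro hk
      have hk' : k < m := by omega
      have : Finset.Iic (⟨k + 1, hk⟩ : Fin m) =
          insert ⟨k + 1, hk⟩ (Finset.Iic (⟨k, hk'⟩ : Fin m)) := by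
        ext i; simp [Fin.le_def, Fin.ext_iff]; omega
      have hnot : (⟨k + 1, hk⟩ : Fin m) ∉ Finset.Iic (⟨k, hk'⟩ : Fin m) := by
        simp [Fin.le_def]
      rw [this, Finset.sum_insert hnot, Finset.sum_insert hnot, mul_add]
      have hle : a ⟨k + 1, hk⟩ ≤ a ⟨k, hk'⟩ := ha (by simp [Fin.le_def])
      have := mul_le_mul_of_nonneg_right hle (hd ⟨k, hk'⟩)
      linarith [ih hk']
  rcases m with _ | m
  · simp
  · have h := key m (Nat.lt_succ_self m)
    have hI : Finset.Iic (⟨m, Nat.lt_succ_self m⟩ : Fin (m + 1)) = Finset.univ := by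
      ext i; simp [Fin.le_def]; omega
    have h0 := mul_nonneg (ha0 ⟨m, Nat.lt_succ_self m⟩) (hd ⟨m, Nat.lt_succ_self m⟩)
    rw [hI] at h h0
    exact h0.trans h

/-- A bilinear pairing of antitone nonnegative sequences through a doubly substochastic matrix is
at most their diagonal pairing. -/
theorem sum_mul_substochastic_le {m : ℕ} (a b : Fin m → ℝ) (ha : Antitone a) (hb : Antitone b)
    (ha0 : ∀ i, 0 ≤ a i) (hb0 : ∀ i, 0 ≤ b i) (S : Matrix (Fin m) (Fin m) ℝ)
    (hS : ∀ i j, 0 ≤ S i j) (hrow : ∀ i, ∑ j, S i j ≤ 1) (hcol : ∀ j, ∑ i, S i j ≤ 1) :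
    ∑ i, ∑ j, a i * b j * S i j ≤ ∑ i, a i * b i := by
  have h := Fin.sum_mul_nonneg_of_antitone a (fun i => b i - ∑ j, b j * S i j) ha ha0 ?_
  · simp only [mul_sub, Finset.sum_sub_distrib, Finset.mul_sum, ← mul_assoc] at h
    linarith
  intro k
  set t : Fin m → ℝ := fun j => ∑ i ∈ Finset.Iic k, S i j with ht
  have ht0 : ∀ j, 0 ≤ t j := fun j => Finset.sum_nonneg fun i _ => hS i j
  have ht1 : ∀ j, t j ≤ 1 := fun j =>
    (Finset.sum_le_univ_sum_of_nonneg fun i => hS i j).trans (hcol j)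
  set p : Fin m → ℝ := fun j => if j ∈ Finset.Iic k then 1 else 0 with hp
  have hpt : ∑ j, t j ≤ ∑ j, p j := by
    have h1 : ∑ j, p j = ∑ i ∈ Finset.Iic k, (1 : ℝ) := by
      rw [hp, Finset.sum_ite_mem, Finset.univ_inter]
    rw [h1, Finset.sum_comm]
    exact Finset.sum_le_sum fun i _ => hrow i
  have hsum : ∑ i ∈ Finset.Iic k, (b i - ∑ j, b j * S i j) = ∑ j, b j * (p j - t j) := by
    rw [Finset.sum_sub_distrib, Finset.sum_comm]
    simp only [mul_sub, Finset.sum_sub_distrib, ht, Finset.mul_sum]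
    simp only [hp, mul_ite, mul_one, mul_zero, Finset.sum_ite_mem, Finset.univ_inter]
  have hterm : ∀ j, b k * (p j - t j) ≤ b j * (p j - t j) := fun j => by
    by_cases hj : j ≤ k
    · exact mul_le_mul_of_nonneg_right (hb hj) (by simp [hp, hj, ht1 j])
    · exact mul_le_mul_of_nonpos_right (hb (not_le.mp hj).le) (by simp [hp, hj, ht0 j])
  rw [hsum]
  refine le_trans ?_ (Finset.sum_le_sum fun j _ => hterm j)
  rw [← Finset.mul_sum, Finset.sum_sub_distrib]
  exact mul_nonneg (hb0 k) (sub_nonneg.mpr hpt)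

/-- If the columns of `V` and of `Z` are pairwise orthogonal of norm at most one, then the rows
of `Vᵀ * Z` have norm at most one. -/
theorem sum_sq_transpose_mul_le_one {I J K : Type*} [Fintype I] [DecidableEq I] [Fintype J]
    [Fintype K] [DecidableEq K] (V : Matrix J I ℝ) (Z : Matrix J K ℝ) (e : I → ℝ) (f : K → ℝ)
    (he : ∀ i, e i ≤ 1) (hf : ∀ i, f i ≤ 1) (hV : Vᵀ * V = Matrix.diagonal e)
    (hZ : Zᵀ * Z = Matrix.diagonal f) (i : I) : ∑ k, (Vᵀ * Z) i k ^ 2 ≤ 1 := by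
  have h := sum_sq_transpose_mulVec_le Z f hf hZ (fun j => V j i)
  have h1 : (fun j => V j i) ⬝ᵥ (fun j => V j i) = e i := by
    have := congrFun (congrFun hV i) i
    rwa [Matrix.diagonal_apply_eq] at this
  have h2 : ∀ k, (Vᵀ * Z) i k = (Zᵀ *ᵥ fun j => V j i) k := fun k => by
    simp [Matrix.mul_apply, Matrix.mulVec, dotProduct, mul_comm]
  simp only [h2]
  linarith [he i]

/-- von Neumann's trace inequality for real matrices. -/
theorem vonNeumann_trace_inequality (m n : ℕ) (hmn : m ≤ n)
    (A B : Matrix (Fin m) (Fin n) ℝ) :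
    (Aᵀ * B).trace ≤ ∑ k : Fin m, singularValues A k * singularValues B k := by
  obtain ⟨U, V, e, hU, he, hV, hA⟩ := exists_eq_mul_diagonal_singularValues_mul_transpose A
  obtain ⟨W, Z, f, hW, hf, hZ, hB⟩ := exists_eq_mul_diagonal_singularValues_mul_transpose B
  set a := singularValues A
  set b := singularValues B
  rw [← Matrix.diagonal_one] at hU hW
  have htrace : (Aᵀ * B).trace = ∑ i, ∑ j, a i * b j * ((Uᵀ * W) i j * (Vᵀ * Z) i j) := by
    have h1 : (Aᵀ * B).trace =
        ((Matrix.diagonal a * (Uᵀ * W)) * (Vᵀ * Z * Matrix.diagonal b)ᵀ).trace := by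
      rw [hA, hB]
      simp only [Matrix.transpose_mul, Matrix.transpose_transpose, Matrix.diagonal_transpose,
        Matrix.mul_assoc]
      rw [Matrix.trace_mul_comm V]
      simp only [Matrix.mul_assoc]
    rw [h1]
    simp only [Matrix.trace, Matrix.diag_apply, Matrix.mul_apply (M := Matrix.diagonal a * _),
      Matrix.transpose_apply, Matrix.diagonal_mul, Matrix.mul_diagonal]
    exact Finset.sum_congr rfl fun i _ => Finset.sum_congr rfl fun j _ => by ring
  let S : Matrix (Fin m) (Fin m) ℝ :=
    fun i j => ((Uᵀ * W) i j ^ 2 + (Vᵀ * Z) i j ^ 2) / 2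
  have hswap : ∀ {K : Type} [Fintype K] (X Y : Matrix K (Fin m) ℝ) (i j),
      (Xᵀ * Y) i j = (Yᵀ * X) j i := fun X Y i j => by
    simp [Matrix.mul_apply, mul_comm]
  have hrow : ∀ i, ∑ j, S i j ≤ 1 := fun i => by
    have h1 := sum_sq_transpose_mul_le_one U W _ _ (fun _ => le_rfl) (fun _ => le_rfl) hU hW i
    have h2 := sum_sq_transpose_mul_le_one V Z e f he hf hV hZ i
    simp only [S, ← Finset.sum_div, Finset.sum_add_distrib]
    linarith
  have hcol : ∀ j, ∑ i, S i j ≤ 1 := fun j => by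
    have h1 := sum_sq_transpose_mul_le_one W U _ _ (fun _ => le_rfl) (fun _ => le_rfl) hW hU j
    have h2 := sum_sq_transpose_mul_le_one Z V f e hf he hZ hV j
    simp only [S, ← Finset.sum_div, Finset.sum_add_distrib, hswap U W, hswap V Z]
    linarith
  rw [htrace]
  refine le_trans (Finset.sum_le_sum fun i _ => Finset.sum_le_sum fun j _ => ?_)
    (sum_mul_substochastic_le a b (singularValues_antitone A) (singularValues_antitone B)
      (singularValues_nonneg A) (singularValues_nonneg B) S (fun i j => by positivity) hrow hcol)
  refine mul_le_mul_of_nonneg_left ?_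
    (mul_nonneg (singularValues_nonneg A i) (singularValues_nonneg B j))
  simp only [S]
  linarith [two_mul_le_add_sq ((Uᵀ * W) i j) ((Vᵀ * Z) i j)]
end

section
/- Let X, Y be nonzero order-D real tensors of the same size admitting, for every mode d, simultaneous ordered singular value decompositions X_(d) = U^(d) · Diag(σ^(d)(X)) · (V^(d))ᵀ and Y_(d) = U^(d) · Diag(σ^(d)(Y)) · (V^(d))ᵀ with U^(d), V^(d) orthogonal, and suppose rank(X_(d)) ≤ rank(Y_(d)) =: r_y^(d) for all d. Define the cores S_X = X ×_1 (U^(1))ᵀ ⋯ ×_D (U^(D))ᵀ and S_Y = Y ×_1 (U^(1))ᵀ ⋯ ×_D (U^(D))ᵀ. Then for every multi-index (i_1,…,i_D) with i_d ≤ r_y^(d) for all d and (S_X)_{i_1,…,i_D} ≠ 0, one has (S_Y)_{i_1,…,i_D} ≠ 0, σ^(d)_{i_d}(X) > 0 for all d, and the ratios σ^(1)_{i_1}(X)/σ^(1)_{i_1}(Y) = σ^(2)_{i_2}(X)/σ^(2)_{i_2}(Y) = ⋯ = σ^(D)_{i_D}(X)/σ^(D)_{i_D}(Y) all coincide, are strictly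 positive, and equal (S_X)_{i_1,…,i_D}/(S_Y)_{i_1,…,i_D}. -/
open scoped BigOperators Matrix

variable {D : ℕ} {n : Fin D → ℕ}

theorem sortDesc_antitone {m : ℕ} (v : Fin m → ℝ) : Antitone (sortDesc v) :=
  fun _ _ hab => Tuple.monotone_sort v (Fin.rev_le_rev.mpr hab)

/-- The singular values whose index is smaller than the rank are positive. -/
theorem singularValues_pos_of_lt_rank {m : ℕ} {J : Type*} [Fintype J]
    (A : Matrix (Fin m) J ℝ) (k : Fin m) (hk : (k : ℕ) < A.rank) :
    0 < singularValues A k := by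
  set v := (gram_isHermitian A).eigenvalues with hv
  have hnonneg : ∀ j, 0 ≤ v j := by
    have hpsd : (A * Aᵀ).PosSemidef := by
      simpa [Matrix.conjTranspose_eq_transpose_of_trivial] using
        Matrix.posSemidef_self_mul_conjTranspose A
    exact hpsd.eigenvalues_nonneg
  refine Real.sqrt_pos.mpr ?_
  by_contra! hle
  have hzero : ∀ l : Fin m, k ≤ l → sortDesc v l = 0 := fun l hl =>
    le_antisymm ((sortDesc_antitone v hl).trans hle) (hnonneg _)
  have hcard : A.rank = Fintype.card {j // v j ≠ 0} := by
    rw [← Matrix.rank_self_mul_transpose A]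
    exact (gram_isHermitian A).rank_eq_card_non_zero_eigs
  let f : {j // v j ≠ 0} → Fin (k : ℕ) := fun j =>
    ⟨(((Tuple.sort v).symm j.1).rev : Fin m), by
      by_contra! h
      have := hzero ((Tuple.sort v).symm j.1).rev h
      exact j.2 (by simpa [sortDesc] using this)⟩
  have hf : Function.Injective f := by
    intro a b hab
    have h := Fin.ext (Fin.mk.inj_iff.mp hab)
    exact Subtype.ext ((Tuple.sort v).symm.injective (Fin.rev_injective h))
  have := Fintype.card_le_of_injective f hf
  rw [Fintype.card_fin] at this
  omega

theorem rectDiagJ_mul_apply {m : ℕ} {J K : Type*} [Fintype J]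
    (v : Fin m → ℝ) (M : Matrix J K ℝ) (k : Fin m) (j : K) :
    ((rectDiagJ v : Matrix (Fin m) J ℝ) * M) k j
      = v k * ((rectDiagJ 1 : Matrix (Fin m) J ℝ) * M) k j := by
  simp only [Matrix.mul_apply, Finset.mul_sum, rectDiagJ, Matrix.of_apply, Pi.one_apply]
  refine Finset.sum_congr rfl fun x _ => ?_
  split_ifs <;> simp

theorem transpose_mul_apply_of_eq_mul_rectDiagJ_mul {m : ℕ} {J K : Type*} [Fintype J]
    {U : Matrix (Fin m) (Fin m) ℝ} (hU : U * Uᵀ = 1) {v : Fin m → ℝ} {M : Matrix J K ℝ}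
    {A : Matrix (Fin m) K ℝ} (hA : A = U * (rectDiagJ v : Matrix (Fin m) J ℝ) * M) (k : Fin m) (j : K) :
    (Uᵀ * A) k j = v k * ((rectDiagJ 1 : Matrix (Fin m) J ℝ) * M) k j := by
  rw [hA, Matrix.mul_assoc U, ← Matrix.mul_assoc, mul_eq_one_comm.mp hU, Matrix.one_mul,
    rectDiagJ_mul_apply]

/-- Each core entry is a weighted sum along a row of `(U d)ᵀ * X_(d)`. -/
theorem tuckerMul_transpose_eq_sum_matricize {D : ℕ} {n : Fin D → ℕ}
    (X : (∀ d, Fin (n d)) → ℝ) (U : ∀ d, Matrix (Fin (n d)) (Fin (n d)) ℝ)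
    (d : Fin D) (i : ∀ d, Fin (n d)) :
    tuckerMul X (fun d' => (U d')ᵀ) i
      = ∑ j : ∀ d' : {d' : Fin D // d' ≠ d}, Fin (n d'),
          (∏ d' : {d' : Fin D // d' ≠ d}, U d' (j d') (i d'))
            * ((U d)ᵀ * matricize X d) (i d) j := by
  unfold tuckerMul
  rw [← (Equiv.piSplitAt d fun d' => Fin (n d')).symm.sum_comp, Fintype.sum_prod_type,
    Finset.sum_comm]
  refine Finset.sum_congr rfl fun j _ => ?_
  rw [Matrix.mul_apply, Finset.mul_sum]
  refine Finset.sum_congr rfl fun k _ => ?_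
  have hidx : (Equiv.piSplitAt d fun d' => Fin (n d')).symm (k, j)
      = fun d' => if h : d' = d then Fin.cast (congrArg n h.symm) k else j ⟨d', h⟩ := by
    funext d'
    by_cases h : d' = d
    · subst h
      simp [Equiv.piSplitAt]
    · simp [Equiv.piSplitAt, h]
  rw [hidx, Fintype.prod_eq_mul_prod_subtype_ne _ d]
  have hprod : ∀ d' : {d' : Fin D // d' ≠ d},
      (fun d' => if h : d' = d then Fin.cast (congrArg n h.symm) k else j ⟨d', h⟩) d'.1
        = j d' := fun d' => dif_neg d'.2
  simp only [Matrix.transpose_apply, hprod, matricize, Matrix.of_apply, dite_true, Fin.cast_eq_self]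
  ring

/-- equality of the singular-value ratios on the support of the core. -/
theorem core_ratio_equalities (D : ℕ) (hD : 1 ≤ D) (n : Fin D → ℕ)
    (X Y : (∀ d, Fin (n d)) → ℝ) (hX : X ≠ 0) (hY : Y ≠ 0)
    (U : ∀ d, Matrix (Fin (n d)) (Fin (n d)) ℝ)
    (hU : ∀ d, U d * (U d)ᵀ = 1)
    (hSVD : ∀ d : Fin D,
      ∃ V : Matrix (∀ d' : {d' : Fin D // d' ≠ d}, Fin (n d'))
                   (∀ d' : {d' : Fin D // d' ≠ d}, Fin (n d')) ℝ,
        V * Vᵀ = 1 ∧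
        matricize X d = U d * rectDiagJ (modeSV X d) * Vᵀ ∧
        matricize Y d = U d * rectDiagJ (modeSV Y d) * Vᵀ)
    (hrank : ∀ d : Fin D, (matricize X d).rank ≤ (matricize Y d).rank) :
    ∀ i : ∀ d, Fin (n d),
      (∀ d : Fin D, (i d : ℕ) < (matricize Y d).rank) →
      tuckerMul X (fun d' => (U d')ᵀ) i ≠ 0 →
        tuckerMul Y (fun d' => (U d')ᵀ) i ≠ 0 ∧
        (∀ d : Fin D, 0 < modeSV X d (i d)) ∧
        (∀ d : Fin D, modeSV X d (i d) / modeSV Y d (i d)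
          = tuckerMul X (fun d' => (U d')ᵀ) i / tuckerMul Y (fun d' => (U d')ᵀ) i) ∧
        0 < tuckerMul X (fun d' => (U d')ᵀ) i / tuckerMul Y (fun d' => (U d')ᵀ) i := by
  intro i hi hne
  have hfactor : ∀ d, ∃ q : ℝ,
      tuckerMul X (fun d' => (U d')ᵀ) i = modeSV X d (i d) * q ∧
      tuckerMul Y (fun d' => (U d')ᵀ) i = modeSV Y d (i d) * q := by
    intro d
    obtain ⟨V, -, hVX, hVY⟩ := hSVD d
    refine ⟨∑ j : ∀ d' : {d' : Fin D // d' ≠ d}, Fin (n d'),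
      (∏ d' : {d' : Fin D // d' ≠ d}, U d' (j d') (i d')) *
        ((rectDiagJ 1 : Matrix (Fin (n d)) (∀ d' : {d' : Fin D // d' ≠ d}, Fin (n d')) ℝ) * Vᵀ)
          (i d) j, ?_, ?_⟩
    · rw [tuckerMul_transpose_eq_sum_matricize X U d i, Finset.mul_sum]
      exact Finset.sum_congr rfl fun j _ => by
        rw [transpose_mul_apply_of_eq_mul_rectDiagJ_mul (hU d) hVX, mul_left_comm]
    · rw [tuckerMul_transpose_eq_sum_matricize Y U d i, Finset.mul_sum]
      exact Finset.sum_congr rfl fun j _ => by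
        rw [transpose_mul_apply_of_eq_mul_rectDiagJ_mul (hU d) hVY, mul_left_comm]
  have hYpos : ∀ d, 0 < modeSV Y d (i d) := fun d =>
    singularValues_pos_of_lt_rank _ _ (hi d)
  have hXpos : ∀ d, 0 < modeSV X d (i d) := by
    intro d
    obtain ⟨q, hq, -⟩ := hfactor d
    exact lt_of_le_of_ne (Real.sqrt_nonneg _) (left_ne_zero_of_mul (hq ▸ hne)).symm
  have hratio : ∀ d, modeSV X d (i d) / modeSV Y d (i d)
      = tuckerMul X (fun d' => (U d')ᵀ) i / tuckerMul Y (fun d' => (U d')ᵀ) i := by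
    intro d
    obtain ⟨q, hqX, hqY⟩ := hfactor d
    rw [hqX, hqY, mul_div_mul_right _ _ (right_ne_zero_of_mul (hqX ▸ hne))]
  refine ⟨?_, hXpos, hratio, ?_⟩
  · obtain ⟨q, hqX, hqY⟩ := hfactor ⟨0, hD⟩
    rw [hqY]
    exact mul_ne_zero (hYpos _).ne' (right_ne_zero_of_mul (hqX ▸ hne))
  · rw [← hratio ⟨0, hD⟩]
    exact div_pos (hXpos _) (hYpos _)
end
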